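/- arXiv:2510.22563 — 4 statements merged into one kernel-verified Lean document; each statement's English description precedes it below -/
import Mathlib

section
/- Let p be a prime, n ≥ 1, and let F be a map from an open subset U of ℚ_p^n into ℚ_p^n having a strict Fréchet derivative A at a point a ∈ U with ‖A − id‖ < 1, where ‖·‖ is the operator norm induced by the sup norm on ℚ_p^n. Then there exists r₀ > 0 such that ‖F(x) − F(y)‖ = ‖x − y‖ for all x, y in the closed ball of radius r₀ around a, and for every real r with 0 < r ≤ r₀ the image F(closedBall(a, r)) is exactly the closed ball closedBall(F(a), r). In particular, F takes every sufficiently small closed ball around a onto a ball of equal radius. -/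
open Set

/-- In an ultrametric group, a map whose difference with the identity is a strict contraction
on `s` is an isometry on `s`. -/
theorem norm_sub_eq_of_lipschitzOnWith_sub_id {E : Type*} [NormedAddCommGroup E]
    [IsUltrametricDist E] {F : E → E} {K : NNReal} {s : Set E} (hK : K < 1)
    (h : LipschitzOnWith K (fun x => F x - x) s) {x y : E} (hx : x ∈ s) (hy : y ∈ s) :
    ‖F x - F y‖ = ‖x - y‖ := by
  rcases eq_or_ne x y with rfl | hxy
  · simp
  have hpos : 0 < ‖x - y‖ := norm_pos_iff.2 (sub_ne_zero.2 hxy)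
  have hlt : ‖(F x - x) - (F y - y)‖ < ‖x - y‖ :=
    (h.norm_sub_le hx hy).trans_lt (mul_lt_of_lt_one_left hpos hK)
  have hsum : F x - F y = (x - y) + ((F x - x) - (F y - y)) := by abel
  rw [hsum, IsUltrametricDist.norm_add_eq_max_of_norm_ne_norm hlt.ne', max_eq_left hlt.le]

/-- In a complete ultrametric group, a map whose difference with the identity is a strict
contraction on a closed ball maps this ball onto the closed ball of the same radius around the
image of its centre. -/
theorem image_closedBall_of_lipschitzOnWith_sub_id {E : Type*} [NormedAddCommGroup E]
    [IsUltrametricDist E] [CompleteSpace E] {F : E → E} {K : NNReal} {a : E} {r : ℝ}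
    (hr : 0 ≤ r) (hK : K < 1)
    (h : LipschitzOnWith K (fun x => F x - x) (Metric.closedBall a r)) :
    F '' Metric.closedBall a r = Metric.closedBall (F a) r := by
  have haB : a ∈ Metric.closedBall a r := Metric.mem_closedBall_self hr
  apply Subset.antisymm
  · rintro _ ⟨x, hx, rfl⟩
    rw [mem_closedBall_iff_norm, norm_sub_eq_of_lipschitzOnWith_sub_id hK h hx haB]
    exact mem_closedBall_iff_norm.1 hx
  · intro y hy
    have hmaps : MapsTo (fun x => y - (F x - x)) (Metric.closedBall a r)
        (Metric.closedBall a r) := by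
      intro x hx
      have hle : ‖(F a - a) - (F x - x)‖ ≤ r := by
        rw [norm_sub_rev]
        exact ((h.norm_sub_le hx haB).trans
          (mul_le_of_le_one_left (norm_nonneg _) hK.le)).trans (mem_closedBall_iff_norm.1 hx)
      have hsum : y - (F x - x) - a = (y - F a) + ((F a - a) - (F x - x)) := by abel
      rw [mem_closedBall_iff_norm, hsum]
      exact (IsUltrametricDist.norm_add_le_max _ _).trans
        (max_le (mem_closedBall_iff_norm.1 hy) hle)
    have hcontr : ContractingWith K (hmaps.restrict _ _ _) := by
      refine ⟨hK, LipschitzOnWith.mapsToRestrict hmaps (LipschitzOnWith.of_dist_le_mul ?_)⟩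
      intro u hu v hv
      rw [dist_sub_left]
      exact h.dist_le_mul u hu v hv
    obtain ⟨x, hx, hfix, -⟩ := hcontr.exists_fixedPoint' Metric.isClosed_closedBall.isComplete
      hmaps haB (edist_ne_top _ _)
    refine ⟨x, hx, ?_⟩
    have hfix' : y - (F x - x) = x := hfix
    rw [sub_eq_iff_eq_add] at hfix'
    rw [hfix']
    abel

/-- If a map `F` on an open subset `U` of `ℚ_p^n` has a strict Fréchet
derivative `A` at `a ∈ U` with `‖A − id‖ < 1` (operator norm for the sup norm on
`ℚ_p^n`), then on some small closed ball around `a` contained in `U` the map `F` is an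
isometry, and it takes every closed ball `closedBall(a, r)` with `0 < r ≤ r₀` onto the
closed ball `closedBall(F(a), r)` of equal radius. -/
theorem equalising_of_strict_deriv_close_to_id (p : ℕ) [Fact p.Prime]
    (n : ℕ) (hn : 1 ≤ n)
    (U : Set (Fin n → ℚ_[p])) (hU : IsOpen U) (a : Fin n → ℚ_[p]) (ha : a ∈ U)
    (F : (Fin n → ℚ_[p]) → (Fin n → ℚ_[p]))
    (A : (Fin n → ℚ_[p]) →L[ℚ_[p]] (Fin n → ℚ_[p]))
    (hF : HasStrictFDerivAt F A a)
    (hA : ‖A - ContinuousLinearMap.id ℚ_[p] (Fin n → ℚ_[p])‖ < 1) :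
    ∃ r₀ : ℝ, 0 < r₀ ∧ Metric.closedBall a r₀ ⊆ U ∧
      (∀ x ∈ Metric.closedBall a r₀, ∀ y ∈ Metric.closedBall a r₀,
        ‖F x - F y‖ = ‖x - y‖) ∧
      ∀ r : ℝ, 0 < r → r ≤ r₀ →
        F '' Metric.closedBall a r = Metric.closedBall (F a) r := by
  obtain ⟨K, hAK, hK⟩ := exists_between (show ‖A - ContinuousLinearMap.id _ _‖₊ < 1 from hA)
  obtain ⟨s, hs, hlip⟩ :=
    (hF.sub (hasStrictFDerivAt_id a)).exists_lipschitzOnWith_of_nnnorm_lt K hAK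
  obtain ⟨r₀, hr₀, hball⟩ :=
    Metric.nhds_basis_closedBall.mem_iff.1 (Filter.inter_mem hs (hU.mem_nhds ha))
  have hlip₀ : LipschitzOnWith K (fun x => F x - x) (Metric.closedBall a r₀) :=
    hlip.mono (hball.trans inter_subset_left)
  refine ⟨r₀, hr₀, hball.trans inter_subset_right, fun x hx y hy => ?_, fun r hr hrr₀ => ?_⟩
  · exact norm_sub_eq_of_lipschitzOnWith_sub_id hK hlip₀ hx hy
  · exact image_closedBall_of_lipschitzOnWith_sub_id hr.le hK
      (hlip₀.mono (Metric.closedBall_subset_closedBall hrr₀))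
end

section
/- Let p be a prime, n ≥ 1, fix i₀ ∈ Fin n, let D = {z ∈ ℚ_p^n : |z_k|_p ≤ 1 for all k, and |z_{i₀}|_p = 1}, and let T : ℚ_p^n → ℚ_p^n be defined on D by T(z)_{i₀} = (z_{i₀})⁻¹ and T(z)_k = z_k · (z_{i₀})⁻¹ for k ≠ i₀. Then T preserves the Haar measure on D: for every measurable set S ⊆ D, vol(T(S)) = vol(S), where vol is the n-fold product on ℚ_p^n of the Haar measure on ℚ_p normalized by vol(ℤ_p) = 1. -/
open Set MeasureTheory

/-- The image `D` of the overlap of two standard charts of `ℙⁿ(ℚ_p)`: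
integral points whose `i₀`-th coordinate is a unit. -/
def projOverlap (p : ℕ) [Fact p.Prime] (n : ℕ) (i₀ : Fin n) : Set (Fin n → ℚ_[p]) :=
  {z | (∀ k, ‖z k‖ ≤ 1) ∧ ‖z i₀‖ = 1}

/-- The transition map of the standard atlas of `ℙⁿ(ℚ_p)` between the charts indexed by
`i₀` and the chart at infinity: `T(z)_{i₀} = z_{i₀}⁻¹`, `T(z)_k = z_k ⋅ z_{i₀}⁻¹`. -/
noncomputable def projTransition (p : ℕ) [Fact p.Prime] (n : ℕ) (i₀ : Fin n) :
    (Fin n → ℚ_[p]) → (Fin n → ℚ_[p]) :=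
  fun z k => if k = i₀ then (z i₀)⁻¹ else z k * (z i₀)⁻¹

section ProjTransition

variable {p : ℕ} [Fact p.Prime] {n : ℕ} {i₀ : Fin n}

theorem projTransition_mem_projOverlap {z : Fin n → ℚ_[p]} (hz : z ∈ projOverlap p n i₀) :
    projTransition p n i₀ z ∈ projOverlap p n i₀ := by
  obtain ⟨h1, h2⟩ := hz
  refine ⟨fun k => ?_, by simp [projTransition, h2]⟩
  by_cases hk : k = i₀
  · simp [projTransition, hk, h2]
  · simpa [projTransition, hk, h2] using h1 k

theorem projTransition_projTransition {z : Fin n → ℚ_[p]} (hz : z ∈ projOverlap p n i₀) :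
    projTransition p n i₀ (projTransition p n i₀ z) = z := by
  have h0 : z i₀ ≠ 0 := norm_ne_zero_iff.1 (by rw [hz.2]; exact one_ne_zero)
  funext k
  by_cases hk : k = i₀
  · simp [projTransition, hk]
  · simp [projTransition, hk, h0]

theorem image_projTransition_eq {S : Set (Fin n → ℚ_[p])} (hS : S ⊆ projOverlap p n i₀) :
    projTransition p n i₀ '' S = projTransition p n i₀ ⁻¹' S ∩ projOverlap p n i₀ := by
  ext z
  constructor
  · rintro ⟨w, hw, rfl⟩
    refine ⟨?_, projTransition_mem_projOverlap (hS hw)⟩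
    rwa [mem_preimage, projTransition_projTransition (hS hw)]
  · rintro ⟨hz, hzD⟩
    exact ⟨_, hz, projTransition_projTransition hzD⟩

/-- The transition map does not increase distances on the overlap. -/
theorem dist_projTransition_le {z w : Fin n → ℚ_[p]} (hz : z ∈ projOverlap p n i₀)
    (hw : w ∈ projOverlap p n i₀) :
    dist (projTransition p n i₀ z) (projTransition p n i₀ w) ≤ dist z w := by
  have hz0 : z i₀ ≠ 0 := norm_ne_zero_iff.1 (by rw [hz.2]; exact one_ne_zero)
  have hw0 : w i₀ ≠ 0 := norm_ne_zero_iff.1 (by rw [hw.2]; exact one_ne_zero)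
  have hi : ‖w i₀ - z i₀‖ ≤ dist z w := by
    rw [← dist_eq_norm, dist_comm]
    exact dist_le_pi_dist z w i₀
  refine (dist_pi_le_iff dist_nonneg).2 fun k => ?_
  rw [dist_eq_norm]
  by_cases hk : k = i₀
  · have h : (z i₀)⁻¹ - (w i₀)⁻¹ = (w i₀ - z i₀) * (z i₀)⁻¹ * (w i₀)⁻¹ := by
      field_simp
    simpa [projTransition, hk, h, hz.2, hw.2] using hi
  · have h : z k * (z i₀)⁻¹ - w k * (w i₀)⁻¹ =
        (z k - w k) * (z i₀)⁻¹ + w k * ((w i₀ - z i₀) * (z i₀)⁻¹ * (w i₀)⁻¹) := by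
      field_simp
      ring
    simp only [projTransition, hk, if_false, h]
    refine (Padic.nonarchimedean _ _).trans (max_le ?_ ?_)
    · simpa [hz.2, dist_eq_norm] using dist_le_pi_dist z w k
    · simp only [norm_mul, norm_inv, hz.2, hw.2, inv_one, mul_one]
      exact (mul_le_of_le_one_left (norm_nonneg _) (hw.1 k)).trans hi

theorem dist_projTransition_left {z w : Fin n → ℚ_[p]} (hz : z ∈ projOverlap p n i₀)
    (hw : w ∈ projOverlap p n i₀) :
    dist (projTransition p n i₀ z) w = dist z (projTransition p n i₀ w) := by
  apply le_antisymm
  · simpa only [projTransition_projTransition hw] using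
      dist_projTransition_le hz (projTransition_mem_projOverlap hw)
  · simpa only [projTransition_projTransition hz] using
      dist_projTransition_le (projTransition_mem_projOverlap hz) hw

theorem ball_subset_projOverlap {x : Fin n → ℚ_[p]} (hx : x ∈ projOverlap p n i₀) {r : ℝ}
    (hr : r ≤ 1) : Metric.ball x r ⊆ projOverlap p n i₀ := by
  intro y hy
  have hd (k : Fin n) : ‖y k - x k‖ < 1 := by
    rw [← dist_eq_norm]
    exact (dist_le_pi_dist y x k).trans_lt ((Metric.mem_ball.1 hy).trans_le hr)
  refine ⟨fun k => ?_, ?_⟩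
  · have := Padic.nonarchimedean (y k - x k) (x k)
    rw [sub_add_cancel] at this
    exact this.trans (max_le (hd k).le (hx.1 k))
  · have := Padic.add_eq_max_of_ne (q := y i₀ - x i₀) (r := x i₀)
      (by rw [hx.2]; exact (hd i₀).ne)
    rwa [sub_add_cancel, hx.2, max_eq_right (hd i₀).le] at this

theorem measurable_projTransition [MeasurableSpace ℚ_[p]] [BorelSpace ℚ_[p]] :
    Measurable (projTransition p n i₀) := by
  refine measurable_pi_lambda _ fun k => ?_
  by_cases hk : k = i₀
  · simp only [projTransition, hk, if_true]
    fun_prop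
  · simp only [projTransition, hk, if_false]
    fun_prop

end ProjTransition

/-- Two finite measures on a second countable ultrametric space agree as soon as they agree
on all balls of radius at most `1`. -/
theorem MeasureTheory.Measure.ext_of_ball_of_isUltrametricDist {X : Type*} [PseudoMetricSpace X]
    [IsUltrametricDist X] [SecondCountableTopology X] [MeasurableSpace X] [BorelSpace X]
    {μ ν : Measure X} [IsFiniteMeasure μ] (huniv : μ univ = ν univ)
    (h : ∀ x r, r ≤ 1 → μ (Metric.ball x r) = ν (Metric.ball x r)) : μ = ν := by
  let C : Set (Set X) := {s | ∃ x r, r ≤ 1 ∧ s = Metric.ball x r}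
  have hC : TopologicalSpace.IsTopologicalBasis C := by
    refine TopologicalSpace.isTopologicalBasis_of_isOpen_of_nhds ?_ ?_
    · rintro _ ⟨x, r, -, rfl⟩
      exact Metric.isOpen_ball
    · intro x u hx hu
      obtain ⟨ε, hε, hsub⟩ := Metric.isOpen_iff.1 hu x hx
      exact ⟨_, ⟨x, min ε 1, min_le_right _ _, rfl⟩,
        Metric.mem_ball_self (lt_min hε one_pos),
        (Metric.ball_subset_ball (min_le_left _ _)).trans hsub⟩
  refine ext_of_generate_finite C ?_ ?_ ?_ huniv
  · rw [BorelSpace.measurable_eq (α := X)]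
    exact hC.borel_eq_generateFrom
  · rintro _ ⟨x, r, hr, rfl⟩ _ ⟨y, s, hs, rfl⟩ ⟨z, hzx, hzy⟩
    rw [IsUltrametricDist.ball_eq_of_mem hzx, IsUltrametricDist.ball_eq_of_mem hzy]
    refine ⟨z, min r s, (min_le_left _ _).trans hr, ?_⟩
    ext w
    simp
  · rintro _ ⟨x, r, hr, rfl⟩
    exact h x r hr

/-- The transition map `T` of the standard atlas of `ℙⁿ(ℚ_p)` preserves
the Haar measure on the overlap `D`: for every measurable `S ⊆ D`,
`vol(T(S)) = vol(S)`, where `vol` is the `n`-fold product of the Haar measure on `ℚ_p`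
normalised by `vol(ℤ_p) = 1`. -/
theorem projTransition_measurePreserving (p : ℕ) [Fact p.Prime] (n : ℕ) (hn : 1 ≤ n)
    (i₀ : Fin n) [MeasurableSpace ℚ_[p]] [BorelSpace ℚ_[p]]
    (μ : Measure ℚ_[p]) [μ.IsAddHaarMeasure]
    (hμ : μ (Metric.closedBall (0 : ℚ_[p]) 1) = 1) :
    ∀ S : Set (Fin n → ℚ_[p]), S ⊆ projOverlap p n i₀ → MeasurableSet S →
      Measure.pi (fun _ : Fin n => μ) (projTransition p n i₀ '' S) =
        Measure.pi (fun _ : Fin n => μ) S := by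
  intro S hSD hS
  set ν := Measure.pi (fun _ : Fin n => μ)
  have hball (x y : Fin n → ℚ_[p]) (r : ℝ) : ν (Metric.ball x r) = ν (Metric.ball y r) := by
    have := measure_preimage_add ν (x - y) (Metric.ball x r)
    rw [← this, preimage_add_ball, sub_sub_cancel]
  have hDfin : ν (projOverlap p n i₀) < ⊤ := by
    refine (measure_mono fun z hz => ?_).trans_lt
      (measure_closedBall_lt_top (μ := ν) (x := 0) (r := 1))
    rw [mem_closedBall_zero_iff]
    exact (pi_norm_le_iff_of_nonneg zero_le_one).2 hz.1
  have : IsFiniteMeasure (ν.restrict (projOverlap p n i₀)) := ⟨by simpa using hDfin⟩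
  have hT := measurable_projTransition (p := p) (i₀ := i₀)
  have key : ν.restrict (projOverlap p n i₀) =
      (ν.restrict (projOverlap p n i₀)).map (projTransition p n i₀) := by
    refine Measure.ext_of_ball_of_isUltrametricDist ?_ fun x r hr => ?_
    · rw [Measure.map_apply hT MeasurableSet.univ, preimage_univ]
    rw [Measure.map_apply hT measurableSet_ball, Measure.restrict_apply measurableSet_ball,
      Measure.restrict_apply (hT measurableSet_ball)]
    rcases (Metric.ball x r ∩ projOverlap p n i₀).eq_empty_or_nonempty with he | ⟨y, hy, hyD⟩
    · have he' : projTransition p n i₀ ⁻¹' Metric.ball x r ∩ projOverlap p n i₀ = ∅ :=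
        eq_empty_of_forall_notMem fun z hz =>
          he.le ⟨hz.1, projTransition_mem_projOverlap hz.2⟩
      rw [he, he']
    · have hTy := projTransition_mem_projOverlap hyD
      rw [IsUltrametricDist.ball_eq_of_mem hy,
        inter_eq_left.2 (ball_subset_projOverlap hyD hr),
        hball y (projTransition p n i₀ y)]
      congr 1
      ext z
      constructor
      · intro hz
        have hzD := ball_subset_projOverlap hTy hr hz
        refine ⟨?_, hzD⟩
        rwa [mem_preimage, Metric.mem_ball, dist_projTransition_left hzD hyD]
      · rintro ⟨hz, hzD⟩
        rwa [mem_preimage, Metric.mem_ball, dist_projTransition_left hzD hyD] at hz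
  rw [image_projTransition_eq hSD, ← Measure.restrict_apply (hT hS), ← Measure.map_apply hT hS,
    ← key, Measure.restrict_apply hS, inter_eq_left.2 hSD]
end

section
/- Let p be a prime and s ∈ ℝ. The Hilbert space L²(ℤ_p, vol; ℂ) admits an orthonormal Hilbert basis consisting of locally constant functions, each member f of which is an eigenfunction of the Vladimirov–Taibleson-type operator Δ^s: there exists λ_f ∈ ℝ such that for every x ∈ ℤ_p, ∫_{ℤ_p} |x − y|_p^{-s} (f(x) − f(y)) dvol(y) = λ_f · f(x). -/
open Set MeasureTheory

open scoped ComplexConjugate BoundedContinuousFunction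

noncomputable section

namespace PadicFourier

variable {p : ℕ} [Fact p.Prime]

/-- The retraction of `ℚ_[p]` onto `ℤ_[p]` sending everything outside `ℤ_[p]` to `0`. -/
def retract (p : ℕ) [Fact p.Prime] (x : ℚ_[p]) : ℤ_[p] :=
  open Classical in if h : ‖x‖ ≤ 1 then ⟨x, h⟩ else 0

theorem retract_of_norm_le_one {x : ℚ_[p]} (h : ‖x‖ ≤ 1) : retract p x = ⟨x, h⟩ := dif_pos h

theorem retract_of_one_lt_norm {x : ℚ_[p]} (h : 1 < ‖x‖) : retract p x = 0 :=
  dif_neg (not_le.mpr h)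

@[simp]
theorem retract_coe (x : ℤ_[p]) : retract p (x : ℚ_[p]) = x :=
  retract_of_norm_le_one x.norm_le_one

theorem continuous_retract : Continuous (retract p) := by
  have hopen : IsOpen {x : ℚ_[p] | ‖x‖ ≤ 1} := by
    simpa [Metric.closedBall, dist_eq_norm] using
      IsUltrametricDist.isOpen_closedBall (0 : ℚ_[p]) one_ne_zero
  rw [continuous_iff_continuousAt]
  intro x
  by_cases hx : ‖x‖ ≤ 1
  · have hcont : ContinuousOn (retract p) {x : ℚ_[p] | ‖x‖ ≤ 1} := by
      rw [continuousOn_iff_continuous_domRestrict]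
      exact continuous_id.congr fun y => (retract_coe (p := p) y).symm
    exact hcont.continuousAt (hopen.mem_nhds hx)
  · have hlt : ∀ᶠ y : ℚ_[p] in nhds x, 1 < ‖y‖ :=
      continuous_norm.continuousAt.eventually_const_lt (not_le.mp hx)
    refine continuousAt_const (y := (0 : ℤ_[p])) |>.congr ?_
    filter_upwards [hlt] with y hy
    exact (retract_of_one_lt_norm hy).symm

/-- Extension of continuous functions on `ℤ_[p]` to `ℚ_[p]` along `retract`. -/
def extend (p : ℕ) [Fact p.Prime] : C(ℤ_[p], ℂ) →L[ℂ] (ℚ_[p] →ᵇ ℂ) :=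
  LinearMap.mkContinuous
    { toFun := fun g => (BoundedContinuousFunction.mkOfCompact g).compContinuous
        ⟨retract p, continuous_retract⟩
      map_add' := fun _ _ => rfl
      map_smul' := fun _ _ => rfl } 1 fun g => by
    rw [one_mul]
    exact (BoundedContinuousFunction.norm_le (norm_nonneg g)).2
      fun x => g.norm_coe_le_norm (retract p x)

@[simp]
theorem extend_apply (g : C(ℤ_[p], ℂ)) (x : ℚ_[p]) : extend p g x = g (retract p x) := rfl

/-- The unitary characters of `ℤ_[p]` that are trivial on some ball around `0`. -/
def smoothChar (p : ℕ) [Fact p.Prime] : Submonoid C(ℤ_[p], ℂ) where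
  carrier := {φ | (∀ x y, φ (x + y) = φ x * φ y) ∧ (∀ x, ‖φ x‖ = 1) ∧
    ∃ n : ℕ, ∀ x : ℤ_[p], ‖x‖ ≤ (p : ℝ) ^ (-n : ℤ) → φ x = 1}
  one_mem' := by simp
  mul_mem' := by
    rintro φ ψ ⟨hφ, hφ', m, hm⟩ ⟨hψ, hψ', n, hn⟩
    have hp : (1 : ℝ) ≤ p := mod_cast (Fact.out : p.Prime).one_le
    refine ⟨fun x y => ?_, fun x => ?_, max m n, fun x hx => ?_⟩
    · simp only [ContinuousMap.mul_apply, hφ, hψ]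
      ring
    · simp [hφ', hψ']
    · rw [ContinuousMap.mul_apply, hm x (hx.trans ?_), hn x (hx.trans ?_), one_mul] <;>
      · apply zpow_le_zpow_right₀ hp
        simp

theorem map_zero {φ : C(ℤ_[p], ℂ)} (hφ : φ ∈ smoothChar p) : φ 0 = 1 := by
  obtain ⟨-, -, n, hn⟩ := hφ
  exact hn 0 (by rw [norm_zero]; positivity)

theorem mul_conj {φ : C(ℤ_[p], ℂ)} (hφ : φ ∈ smoothChar p) (x : ℤ_[p]) :
    φ x * conj (φ x) = 1 := by
  rw [Complex.mul_conj, Complex.normSq_eq_norm_sq, hφ.2.1]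
  simp

theorem map_neg {φ : C(ℤ_[p], ℂ)} (hφ : φ ∈ smoothChar p) (x : ℤ_[p]) :
    φ (-x) = conj (φ x) := by
  have h : φ x * φ (-x) = 1 := by rw [← hφ.1, add_neg_cancel, map_zero hφ]
  have hne : φ x ≠ 0 := left_ne_zero_of_mul_eq_one h
  exact mul_left_cancel₀ hne (h.trans (mul_conj hφ x).symm)

theorem star_mem {φ : C(ℤ_[p], ℂ)} (hφ : φ ∈ smoothChar p) : star φ ∈ smoothChar p := by
  obtain ⟨hadd, hnorm, n, hn⟩ := hφ
  refine ⟨fun x y => by simp [hadd], fun x => by simp [hnorm],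
    n, fun x hx => by simp [hn x hx]⟩

/-- The pullback to `ℤ_[p]` of the standard character of `ℤ / p ^ n`. -/
def levelChar (p : ℕ) [Fact p.Prime] (n : ℕ) : C(ℤ_[p], ℂ) where
  toFun x := ZMod.stdAddChar (PadicInt.toZModPow n x)
  continuous_toFun := by
    refine IsLocallyConstant.continuous ((IsLocallyConstant.iff_exists_open _).2 fun x => ?_)
    have hp : (0 : ℝ) < p := mod_cast (Fact.out : p.Prime).pos
    refine ⟨Metric.ball x ((p : ℝ) ^ (-n : ℤ)), Metric.isOpen_ball,
      Metric.mem_ball_self (by positivity), fun y hy => ?_⟩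
    have hmem : PadicInt.toZModPow n (y - x) = 0 := by
      rw [← RingHom.mem_ker, PadicInt.ker_toZModPow, ← PadicInt.norm_le_pow_iff_mem_span_pow,
        ← dist_eq_norm]
      exact (Metric.mem_ball.mp hy).le
    rw [map_sub, sub_eq_zero] at hmem
    rw [hmem]

theorem levelChar_apply (n : ℕ) (x : ℤ_[p]) :
    levelChar p n x = ZMod.stdAddChar (PadicInt.toZModPow n x) := rfl

theorem levelChar_mem (n : ℕ) : levelChar p n ∈ smoothChar p := by
  refine ⟨fun x y => ?_, fun x => ?_, n, fun x hx => ?_⟩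
  · simp only [levelChar_apply, map_add, AddChar.map_add_eq_mul]
  · rw [levelChar_apply, ZMod.stdAddChar_apply, Circle.norm_coe]
  · rw [PadicInt.norm_le_pow_iff_mem_span_pow, ← PadicInt.ker_toZModPow, RingHom.mem_ker] at hx
    rw [levelChar_apply, hx, AddChar.map_zero_eq_one]

/-- The star subalgebra of `C(ℤ_[p], ℂ)` generated by the smooth characters. -/
def charSubalgebra (p : ℕ) [Fact p.Prime] : StarSubalgebra ℂ C(ℤ_[p], ℂ) where
  toSubalgebra := Algebra.adjoin ℂ (smoothChar p : Set C(ℤ_[p], ℂ))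
  star_mem' := by
    change Algebra.adjoin ℂ (smoothChar p : Set C(ℤ_[p], ℂ)) ≤
      star (Algebra.adjoin ℂ (smoothChar p : Set C(ℤ_[p], ℂ)))
    exact Algebra.adjoin_le fun φ hφ => Algebra.subset_adjoin (star_mem hφ)

theorem charSubalgebra_separatesPoints : (charSubalgebra p).SeparatesPoints := by
  intro x y hxy
  obtain ⟨n, hn⟩ : ∃ n, PadicInt.toZModPow n x ≠ PadicInt.toZModPow n y := by
    by_contra! h
    exact hxy (PadicInt.ext_of_toZModPow.1 h)
  exact ⟨_, ⟨levelChar p n, Algebra.subset_adjoin (levelChar_mem n), rfl⟩,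
    fun h => hn (ZMod.injective_stdAddChar h)⟩

theorem span_smoothChar_topologicalClosure :
    (Submodule.span ℂ (smoothChar p : Set C(ℤ_[p], ℂ))).topologicalClosure = ⊤ := by
  have hspan := Algebra.adjoin_eq_span ℂ (smoothChar p : Set C(ℤ_[p], ℂ))
  rw [Submonoid.closure_eq] at hspan
  rw [← hspan]
  exact congrArg (Subalgebra.toSubmodule <| StarSubalgebra.toSubalgebra ·)
    (ContinuousMap.starSubalgebra_topologicalClosure_eq_top_of_separatesPoints (charSubalgebra p)
      charSubalgebra_separatesPoints)

/-- The unit ball `ℤ_[p]` inside `ℚ_[p]`. -/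
local notation "𝔹" => Metric.closedBall (0 : ℚ_[p]) 1

theorem add_mem_closedBall_iff {a : ℚ_[p]} (ha : a ∈ 𝔹) (y : ℚ_[p]) : y + a ∈ 𝔹 ↔ y ∈ 𝔹 := by
  simp only [mem_closedBall_zero_iff] at *
  refine ⟨fun h => ?_, fun h => (Padic.nonarchimedean y a).trans (max_le h ha)⟩
  have := Padic.nonarchimedean (y + a) (-a)
  rw [add_neg_cancel_right, norm_neg] at this
  exact this.trans (max_le h ha)

theorem retract_add {x y : ℚ_[p]} (hx : x ∈ 𝔹) (hy : y ∈ 𝔹) :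
    retract p (x + y) = retract p x + retract p y := by
  rw [mem_closedBall_zero_iff] at hx hy
  obtain ⟨x, rfl⟩ : ∃ z : ℤ_[p], (z : ℚ_[p]) = x := ⟨⟨x, hx⟩, rfl⟩
  obtain ⟨y, rfl⟩ : ∃ z : ℤ_[p], (z : ℚ_[p]) = y := ⟨⟨y, hy⟩, rfl⟩
  rw [← PadicInt.coe_add]
  simp only [retract_coe]

theorem retract_neg {x : ℚ_[p]} (hx : x ∈ 𝔹) : retract p (-x) = -retract p x := by
  rw [mem_closedBall_zero_iff] at hx
  obtain ⟨x, rfl⟩ : ∃ z : ℤ_[p], (z : ℚ_[p]) = x := ⟨⟨x, hx⟩, rfl⟩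
  rw [← PadicInt.coe_neg]
  simp only [retract_coe]

variable [MeasurableSpace ℚ_[p]] [BorelSpace ℚ_[p]] (μ : Measure ℚ_[p]) [μ.IsAddHaarMeasure]

theorem setIntegral_add_right (g : ℚ_[p] → ℂ) {a : ℚ_[p]} (ha : a ∈ 𝔹) :
    ∫ y in 𝔹, g (y + a) ∂μ = ∫ y in 𝔹, g y ∂μ := by
  rw [← integral_indicator measurableSet_closedBall, ← integral_indicator measurableSet_closedBall,
    ← integral_add_right_eq_self (indicator 𝔹 g) a]
  congr 1 with y
  by_cases hy : y ∈ 𝔹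
  · simp only [indicator_of_mem hy, indicator_of_mem ((add_mem_closedBall_iff ha y).2 hy)]
  · simp only [indicator_of_notMem hy,
      indicator_of_notMem (mt (add_mem_closedBall_iff ha y).1 hy)]

theorem setIntegral_neg (g : ℚ_[p] → ℂ) :
    ∫ y in 𝔹, g (-y) ∂μ = ∫ y in 𝔹, g y ∂μ := by
  rw [← integral_indicator measurableSet_closedBall, ← integral_indicator measurableSet_closedBall,
    ← integral_neg_eq_self (indicator 𝔹 g)]
  congr 1 with y
  simp [indicator]

/-- A smooth character is an eigenfunction of every radial convolution-type difference operator. -/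
theorem exists_eigenvalue {φ : C(ℤ_[p], ℂ)} (hφ : φ ∈ smoothChar p) (k : ℝ → ℝ) :
    ∃ lam : ℝ, ∀ x ∈ 𝔹,
      ∫ y in 𝔹, (k ‖x - y‖ : ℂ) * (φ (retract p x) - φ (retract p y)) ∂μ =
        lam * φ (retract p x) := by
  set I : ℂ := ∫ z in 𝔹, (k ‖z‖ : ℂ) * (1 - φ (retract p z)) ∂μ with hI
  have hreal : conj I = I := by
    rw [hI, ← integral_conj, ← setIntegral_neg]
    refine setIntegral_congr_fun measurableSet_closedBall fun z hz => ?_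
    simp [retract_neg hz, map_neg hφ]
  obtain ⟨lam, hlam⟩ := Complex.conj_eq_iff_real.1 hreal
  refine ⟨lam, fun x hx => ?_⟩
  rw [← hlam, ← setIntegral_add_right μ _ hx, hI, ← integral_mul_const]
  refine setIntegral_congr_fun measurableSet_closedBall fun z hz => ?_
  simp only [retract_add hz hx, hφ.1, sub_add_cancel_right, norm_neg]
  ring

theorem setIntegral_mul_conj_eq_zero {φ ψ : C(ℤ_[p], ℂ)} (hφ : φ ∈ smoothChar p)
    (hψ : ψ ∈ smoothChar p) (hne : φ ≠ ψ) :
    ∫ y in 𝔹, ψ (retract p y) * conj (φ (retract p y)) ∂μ = 0 := by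
  obtain ⟨a, ha⟩ := DFunLike.ne_iff.1 hne
  have ha' : (a : ℚ_[p]) ∈ 𝔹 := mem_closedBall_zero_iff.2 a.norm_le_one
  set I := ∫ y in 𝔹, ψ (retract p y) * conj (φ (retract p y)) ∂μ with hI
  have h : I = I * (ψ a * conj (φ a)) := by
    conv_lhs => rw [hI, ← setIntegral_add_right μ _ ha']
    rw [hI, ← integral_mul_const]
    refine setIntegral_congr_fun measurableSet_closedBall fun z hz => ?_
    simp only [retract_add hz ha', retract_coe, hφ.1, hψ.1, map_mul]
    ring
  by_contra hI0
  have h1 : ψ a * conj (φ a) = 1 := (mul_eq_left₀ hI0).1 h.symm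
  have hne0 : conj (φ a) ≠ 0 := right_ne_zero_of_mul_eq_one h1
  exact ha (mul_right_cancel₀ hne0 ((mul_conj hφ a).trans h1.symm))

instance : IsFiniteMeasure (μ.restrict 𝔹) :=
  isFiniteMeasure_restrict.2 (isCompact_closedBall _ _).measure_ne_top

/-- Continuous functions on `ℤ_[p]` as elements of `L²` of the unit ball. -/
def toL2 : C(ℤ_[p], ℂ) →L[ℂ] Lp ℂ 2 (μ.restrict 𝔹) :=
  (BoundedContinuousFunction.toLp 2 (μ.restrict 𝔹) ℂ).comp (extend p)

theorem coeFn_toL2 (g : C(ℤ_[p], ℂ)) :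
    toL2 μ g =ᵐ[μ.restrict 𝔹] fun x => g (retract p x) :=
  BoundedContinuousFunction.coeFn_toLp 2 (μ.restrict 𝔹) ℂ (extend p g)

theorem denseRange_toL2 : DenseRange (toL2 μ) := by
  refine (BoundedContinuousFunction.toLp_denseRange ℂ (μ.restrict 𝔹) ℂ
    ENNReal.ofNat_ne_top).mono ?_
  rintro - ⟨f, rfl⟩
  refine ⟨⟨fun x : ℤ_[p] => f x, f.continuous.comp continuous_subtype_val⟩, Lp.ext ?_⟩
  filter_upwards [coeFn_toL2 μ ⟨fun x : ℤ_[p] => f x, f.continuous.comp continuous_subtype_val⟩,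
    BoundedContinuousFunction.coeFn_toLp 2 (μ.restrict 𝔹) ℂ f,
    ae_restrict_mem measurableSet_closedBall] with x h1 h2 hx
  rw [h1, h2]
  simp [retract_of_norm_le_one (mem_closedBall_zero_iff.1 hx)]

theorem inner_toL2 (f g : C(ℤ_[p], ℂ)) :
    inner ℂ (toL2 μ f) (toL2 μ g) =
      ∫ y in 𝔹, g (retract p y) * conj (f (retract p y)) ∂μ :=
  BoundedContinuousFunction.inner_toLp (μ.restrict 𝔹) (extend p f) (extend p g)

theorem orthonormal_smoothChar (hμ : μ 𝔹 = 1) :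
    Orthonormal ℂ fun φ : smoothChar p => toL2 μ (φ : C(ℤ_[p], ℂ)) := by
  classical
  rw [orthonormal_iff_ite]
  intro φ ψ
  rw [inner_toL2]
  split_ifs with h
  · subst h
    simp [mul_conj φ.2, measureReal_def, hμ]
  · exact setIntegral_mul_conj_eq_zero μ φ.2 ψ.2 fun h' => h (Subtype.ext h')

theorem span_toL2_smoothChar_topologicalClosure :
    (Submodule.span ℂ
      (range fun φ : smoothChar p => toL2 μ (φ : C(ℤ_[p], ℂ)))).topologicalClosure = ⊤ := by
  have h := (denseRange_toL2 μ).topologicalClosure_map_submodule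
    (span_smoothChar_topologicalClosure (p := p))
  rw [← h, Submodule.map_span, image_eq_range]
  rfl

end PadicFourier

end

open PadicFourier in
/-- For every prime `p` and every `s ∈ ℝ`, the Hilbert space
`L²(ℤ_p, vol; ℂ)` admits an orthonormal Hilbert basis each of whose members is
(a.e. equal to) a locally constant function which is an eigenfunction of the
Vladimirov–Taibleson-type operator
`Δ^s f(x) = ∫_{ℤ_p} |x−y|^{-s} (f(x) − f(y)) dvol(y)` with a real eigenvalue. -/
theorem wavelet_hilbert_basis (p : ℕ) [Fact p.Prime]
    [MeasurableSpace ℚ_[p]] [BorelSpace ℚ_[p]]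
    (μ : Measure ℚ_[p]) [μ.IsAddHaarMeasure]
    (hμ : μ (Metric.closedBall (0 : ℚ_[p]) 1) = 1) (s : ℝ) :
    ∃ (ι : Type) (b : HilbertBasis ι ℂ
        (Lp ℂ 2 (μ.restrict (Metric.closedBall (0 : ℚ_[p]) 1)))),
      ∀ i : ι, ∃ (f : ℚ_[p] → ℂ) (lam : ℝ),
        (⇑(b i) =ᵐ[μ.restrict (Metric.closedBall (0 : ℚ_[p]) 1)] f) ∧
        (∀ x ∈ Metric.closedBall (0 : ℚ_[p]) 1, ∃ δ > (0 : ℝ),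
          ∀ y ∈ Metric.closedBall (0 : ℚ_[p]) 1, ‖y - x‖ ≤ δ → f y = f x) ∧
        ∀ x ∈ Metric.closedBall (0 : ℚ_[p]) 1,
          ∫ y in Metric.closedBall (0 : ℚ_[p]) 1,
              (↑(‖x - y‖ ^ (-s)) : ℂ) * (f x - f y) ∂μ = (lam : ℂ) * f x := by
  refine ⟨smoothChar p, HilbertBasis.mk (orthonormal_smoothChar μ hμ)
    (span_toL2_smoothChar_topologicalClosure μ).ge, fun φ => ?_⟩
  obtain ⟨lam, hlam⟩ := exists_eigenvalue μ φ.2 (· ^ (-s))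
  refine ⟨fun x => (φ : C(ℤ_[p], ℂ)) (retract p x), lam, ?_, fun x hx => ?_, hlam⟩
  · rw [HilbertBasis.coe_mk]
    exact coeFn_toL2 μ _
  · obtain ⟨hadd, -, n, hn⟩ := φ.2
    have hp : (0 : ℝ) < p := mod_cast (Fact.out : p.Prime).pos
    refine ⟨(p : ℝ) ^ (-n : ℤ), by positivity, fun y hy hxy => ?_⟩
    rw [mem_closedBall_zero_iff] at hx hy
    obtain ⟨x, rfl⟩ : ∃ z : ℤ_[p], (z : ℚ_[p]) = x := ⟨⟨x, hx⟩, rfl⟩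
    obtain ⟨y, rfl⟩ : ∃ z : ℤ_[p], (z : ℚ_[p]) = y := ⟨⟨y, hy⟩, rfl⟩
    simp only [retract_coe]
    rw [← sub_add_cancel y x, hadd, hn (y - x) hxy, one_mul]
end

section
/- Let p be a prime, γ, γ' ∈ ℕ, c, c' ∈ ℤ_p, and let B = closedBall(c, p^{-γ}) and B' = closedBall(c', p^{-γ'}) be balls in ℤ_p with B ≠ B' as sets. Let f be a wavelet-type function on B (f : ℚ_p → ℂ vanishes outside B, is constant on every closed ball of radius p^{-γ-1} contained in B, and ∫_{ℤ_p} f dvol = 0), and let g be a wavelet-type function on B' (defined analogously with γ' in place of γ). Then f and g are orthogonal in L²(ℤ_p, vol; ℂ): ∫_{ℤ_p} f(x) · conj(g(x)) dvol(x) = 0. -/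
open Set MeasureTheory

/-- A function supported on the ball `closedBall c (p ^ (-γ))` and constant on its child balls is
constant on every other ball whose radius is at most `p ^ (-γ)`. -/
theorem exists_eq_const_on_closedBall {p : ℕ} [Fact p.Prime] {γ γ' : ℕ} {c c' : ℚ_[p]}
    (hle : γ ≤ γ')
    (hne : Metric.closedBall c ((p : ℝ) ^ (-(γ : ℤ))) ≠
      Metric.closedBall c' ((p : ℝ) ^ (-(γ' : ℤ))))
    {f : ℚ_[p] → ℂ}
    (hfsupp : ∀ x ∉ Metric.closedBall c ((p : ℝ) ^ (-(γ : ℤ))), f x = 0)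
    (hfconst : ∀ a : ℚ_[p],
      Metric.closedBall a ((p : ℝ) ^ (-(γ : ℤ) - 1)) ⊆
          Metric.closedBall c ((p : ℝ) ^ (-(γ : ℤ))) →
        ∀ x ∈ Metric.closedBall a ((p : ℝ) ^ (-(γ : ℤ) - 1)),
          ∀ y ∈ Metric.closedBall a ((p : ℝ) ^ (-(γ : ℤ) - 1)), f x = f y) :
    ∃ k : ℂ, ∀ x ∈ Metric.closedBall c' ((p : ℝ) ^ (-(γ' : ℤ))), f x = k := by
  have hp : (1 : ℝ) ≤ p := by exact_mod_cast (Fact.out : p.Prime).one_le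
  by_cases hmeet : ∃ z ∈ Metric.closedBall c' ((p : ℝ) ^ (-(γ' : ℤ))),
      z ∈ Metric.closedBall c ((p : ℝ) ^ (-(γ : ℤ)))
  · obtain ⟨z, hz', hz⟩ := hmeet
    rw [IsUltrametricDist.closedBall_eq_of_mem hz,
      IsUltrametricDist.closedBall_eq_of_mem hz'] at hne
    rw [IsUltrametricDist.closedBall_eq_of_mem hz] at hfconst
    rw [IsUltrametricDist.closedBall_eq_of_mem hz']
    have hlt : γ < γ' := lt_of_le_of_ne hle fun h => hne (by rw [h])
    have hchild : Metric.closedBall z ((p : ℝ) ^ (-(γ' : ℤ))) ⊆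
        Metric.closedBall z ((p : ℝ) ^ (-(γ : ℤ) - 1)) :=
      Metric.closedBall_subset_closedBall (zpow_le_zpow_right₀ hp (by lia))
    exact ⟨f z, fun x hx => hfconst z
      (Metric.closedBall_subset_closedBall (zpow_le_zpow_right₀ hp (by lia)))
      x (hchild hx) z (Metric.mem_closedBall_self (by positivity))⟩
  · exact ⟨0, fun x hx => hfsupp x fun h => hmeet ⟨x, hx, h⟩⟩

/-- If `g` vanishes outside `s` and has integral zero, then `f * conj g` has integral zero for
every `f` that is constant on `s`. -/
theorem integral_mul_conj_eq_zero_of_const_on {α : Type*} [MeasurableSpace α] {μ : Measure α}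
    {s : Set α} {f g : α → ℂ} {k : ℂ} (hf : ∀ x ∈ s, f x = k) (hg : ∀ x ∉ s, g x = 0)
    (hmean : ∫ x, g x ∂μ = 0) :
    ∫ x, f x * (starRingEnd ℂ) (g x) ∂μ = 0 := by
  have h : ∀ x, f x * (starRingEnd ℂ) (g x) = k * (starRingEnd ℂ) (g x) := fun x => by
    by_cases hx : x ∈ s
    · rw [hf x hx]
    · simp [hg x hx]
  simp_rw [h]
  rw [integral_const_mul, integral_conj, hmean, map_zero, mul_zero]

/-- Wavelet-type functions supported on distinct balls of `ℤ_p` are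
orthogonal in `L²(ℤ_p, vol; ℂ)`: if `f` is a wavelet-type function on
`B = closedBall(c, p^{-γ})` (vanishing outside `B`, constant on every closed ball of
radius `p^{-γ-1}` contained in `B`, of mean zero over `ℤ_p`), `g` is a wavelet-type
function on `B' = closedBall(c', p^{-γ'})`, and `B ≠ B'`, then
`∫_{ℤ_p} f(x) conj(g(x)) dvol(x) = 0`. -/
theorem wavelets_orthogonal (p : ℕ) [Fact p.Prime]
    [MeasurableSpace ℚ_[p]] [BorelSpace ℚ_[p]]
    (μ : Measure ℚ_[p]) [μ.IsAddHaarMeasure]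
    (hμ : μ (Metric.closedBall (0 : ℚ_[p]) 1) = 1)
    (γ γ' : ℕ) (c c' : ℚ_[p])
    (hc : c ∈ Metric.closedBall (0 : ℚ_[p]) 1)
    (hc' : c' ∈ Metric.closedBall (0 : ℚ_[p]) 1)
    (hne : Metric.closedBall c ((p : ℝ) ^ (-(γ : ℤ))) ≠
      Metric.closedBall c' ((p : ℝ) ^ (-(γ' : ℤ))))
    (f g : ℚ_[p] → ℂ)
    (hfsupp : ∀ x ∉ Metric.closedBall c ((p : ℝ) ^ (-(γ : ℤ))), f x = 0)
    (hfconst : ∀ a : ℚ_[p],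
      Metric.closedBall a ((p : ℝ) ^ (-(γ : ℤ) - 1)) ⊆
          Metric.closedBall c ((p : ℝ) ^ (-(γ : ℤ))) →
        ∀ x ∈ Metric.closedBall a ((p : ℝ) ^ (-(γ : ℤ) - 1)),
          ∀ y ∈ Metric.closedBall a ((p : ℝ) ^ (-(γ : ℤ) - 1)), f x = f y)
    (hfmean : ∫ x in Metric.closedBall (0 : ℚ_[p]) 1, f x ∂μ = 0)
    (hgsupp : ∀ x ∉ Metric.closedBall c' ((p : ℝ) ^ (-(γ' : ℤ))), g x = 0)
    (hgconst : ∀ a : ℚ_[p],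
      Metric.closedBall a ((p : ℝ) ^ (-(γ' : ℤ) - 1)) ⊆
          Metric.closedBall c' ((p : ℝ) ^ (-(γ' : ℤ))) →
        ∀ x ∈ Metric.closedBall a ((p : ℝ) ^ (-(γ' : ℤ) - 1)),
          ∀ y ∈ Metric.closedBall a ((p : ℝ) ^ (-(γ' : ℤ) - 1)), g x = g y)
    (hgmean : ∫ x in Metric.closedBall (0 : ℚ_[p]) 1, g x ∂μ = 0) :
    ∫ x in Metric.closedBall (0 : ℚ_[p]) 1, f x * (starRingEnd ℂ) (g x) ∂μ = 0 := by
  rcases le_total γ γ' with hle | hle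
  · obtain ⟨k, hk⟩ := exists_eq_const_on_closedBall hle hne hfsupp hfconst
    exact integral_mul_conj_eq_zero_of_const_on hk hgsupp hgmean
  · obtain ⟨k, hk⟩ := exists_eq_const_on_closedBall hle hne.symm hgsupp hgconst
    have h := integral_mul_conj_eq_zero_of_const_on hk hfsupp hfmean
    rw [← map_eq_zero (starRingEnd ℂ), ← integral_conj]
    simpa [mul_comm] using h
end
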